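/- The number of positive roots of D_n (n ≥ 2) whose support in the Dynkin diagram has a trivalent vertex equals n(n−3)/2; for E_6 it equals 15, and for E_7 it equals 35. -/

import Mathlib

/-- Standard basis vector of `ℚⁿ`. -/
def eQ (n : ℕ) (i : Fin n) : Fin n → ℚ := fun j => if j = i then 1 else 0

/-- Standard dot product on `ℚⁿ`. -/
def dotQ {n : ℕ} (v w : Fin n → ℚ) : ℚ := ∑ i, v i * w i

/-- The positive roots `εᵢ ± εⱼ` (`i < j`) of `D_n`. -/
def DnPos (n : ℕ) : Set (Fin n → ℚ) :=
  {v | ∃ i j : Fin n, i < j ∧ (v = eQ n i - eQ n j ∨ v = eQ n i + eQ n j)}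

/-- The simple roots of `D_n`: `ε₁−ε₂, …, ε_{n−1}−ε_n, ε_{n−1}+ε_n`. -/
def DnSimple (n : ℕ) (k : Fin n) : Fin n → ℚ :=
  if h : (k : ℕ) + 1 < n then eQ n k - eQ n ⟨(k : ℕ) + 1, h⟩
  else eQ n ⟨n - 2, by have := k.isLt; omega⟩ + eQ n ⟨n - 1, by have := k.isLt; omega⟩

/-- The intersection form of `Pic_n` (coordinate `0` is the `h`-coordinate). -/
def picDotQ {n : ℕ} (v w : Fin (n + 1) → ℚ) : ℚ :=
  v 0 * w 0 - ∑ i : Fin n, v i.succ * w i.succ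

def picHQ (n : ℕ) : Fin (n + 1) → ℚ := fun j => if j = 0 then 1 else 0

def picEQ (n : ℕ) (i : Fin n) : Fin (n + 1) → ℚ := fun j => if j = i.succ then 1 else 0

/-- The simple roots of `E_n` (`n = 6, 7`): `e₁−e₂, …, e_{n−1}−e_n, h−e₁−e₂−e₃`. -/
def EnSimple (n : ℕ) [NeZero n] (k : Fin n) : Fin (n + 1) → ℚ :=
  if h : (k : ℕ) + 1 < n then picEQ n k - picEQ n ⟨(k : ℕ) + 1, h⟩
  else picHQ n - picEQ n 0 - picEQ n 1 - picEQ n 2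

/-- The 36 positive roots of `E₆`. -/
def E6Pos : Set (Fin 7 → ℚ) :=
  {α | (∃ i j : Fin 6, i < j ∧ α = picEQ 6 i - picEQ 6 j) ∨
       (∃ i j k : Fin 6, i < j ∧ j < k ∧
          α = picHQ 6 - picEQ 6 i - picEQ 6 j - picEQ 6 k) ∨
       α = (2 : ℚ) • picHQ 6 - ∑ i : Fin 6, picEQ 6 i}

/-- The 63 positive roots of `E₇`. -/
def E7Pos : Set (Fin 8 → ℚ) :=
  {α | (∃ i j : Fin 7, i < j ∧ α = picEQ 7 i - picEQ 7 j) ∨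
       (∃ i j k : Fin 7, i < j ∧ j < k ∧
          α = picHQ 7 - picEQ 7 i - picEQ 7 j - picEQ 7 k) ∨
       (∃ i : Fin 7, α = (2 : ℚ) • picHQ 7 - ∑ j ∈ Finset.univ.erase i, picEQ 7 j)}

/-- `α` is three-legged w.r.t. a system of simple roots and a bilinear form `B`:
writing `α = Σ cᵢ • αᵢ`, some vertex of the support has at least three neighbours
(in the Dynkin diagram, i.e. `B(α_v, α_w) ≠ 0`) inside the support. -/
def ThreeLegged {M : Type*} [AddCommGroup M] [Module ℚ M] {r : ℕ}
    (simple : Fin r → M) (B : M → M → ℚ) (α : M) : Prop :=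
  ∃ c : Fin r → ℚ, α = ∑ i, c i • simple i ∧
    ∃ v : Fin r, c v ≠ 0 ∧
      3 ≤ {w : Fin r | w ≠ v ∧ c w ≠ 0 ∧ B (simple v) (simple w) ≠ 0}.ncard

lemma ncard_le_two_aux {r : ℕ} (S : Set (Fin r)) (a b : Fin r)
    (h : ∀ w ∈ S, w = a ∨ w = b) : S.ncard ≤ 2 := by
  have h1 : S ⊆ {a, b} := fun w hw => by simpa using h w hw
  exact (Set.ncard_le_ncard h1 (Set.toFinite _)).trans (by
    simpa using Set.ncard_insert_le a {b})

/-- If `v0` is the only vertex with more than two neighbours, and its neighbours are `x, y, z`,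
then being three-legged means that the support contains `v0, x, y, z`. -/
lemma threeLegged_iff_aux {M : Type*} [AddCommGroup M] [Module ℚ M] {r : ℕ}
    (s : Fin r → M) (B : M → M → ℚ) (α : M) (v0 x y z : Fin r)
    (hxy : x ≠ y) (hxz : x ≠ z) (hyz : y ≠ z)
    (h0 : ∀ w, (w ≠ v0 ∧ B (s v0) (s w) ≠ 0) ↔ (w = x ∨ w = y ∨ w = z))
    (h1 : ∀ v, v ≠ v0 → ∃ a b, ∀ w, w ≠ v → B (s v) (s w) ≠ 0 → w = a ∨ w = b) :
    ThreeLegged s B α ↔ ∃ c : Fin r → ℚ, α = ∑ i, c i • s i ∧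
      c v0 ≠ 0 ∧ c x ≠ 0 ∧ c y ≠ 0 ∧ c z ≠ 0 := by
  constructor
  · rintro ⟨c, hc, v, hv, h3⟩
    refine ⟨c, hc, ?_⟩
    have hvv : v = v0 := by
      by_contra hne
      obtain ⟨a, b, hab⟩ := h1 v hne
      have := ncard_le_two_aux {w : Fin r | w ≠ v ∧ c w ≠ 0 ∧ B (s v) (s w) ≠ 0} a b
        (fun w hw => hab w hw.1 hw.2.2)
      omega
    subst hvv
    have key : ∀ w ∈ {w : Fin r | w ≠ v ∧ c w ≠ 0 ∧ B (s v) (s w) ≠ 0},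
        (w = x ∨ w = y ∨ w = z) ∧ c w ≠ 0 :=
      fun w hw => ⟨(h0 w).1 ⟨hw.1, hw.2.2⟩, hw.2.1⟩
    refine ⟨hv, ?_, ?_, ?_⟩
    · intro hx
      have := ncard_le_two_aux _ y z (fun w hw => by
        obtain ⟨h | h | h, h'⟩ := key w hw
        · exact absurd (h ▸ hx) h'
        · exact Or.inl h
        · exact Or.inr h)
      omega
    · intro hx
      have := ncard_le_two_aux _ x z (fun w hw => by
        obtain ⟨h | h | h, h'⟩ := key w hw
        · exact Or.inl h
        · exact absurd (h ▸ hx) h'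
        · exact Or.inr h)
      omega
    · intro hx
      have := ncard_le_two_aux _ x y (fun w hw => by
        obtain ⟨h | h | h, h'⟩ := key w hw
        · exact Or.inl h
        · exact Or.inr h
        · exact absurd (h ▸ hx) h')
      omega
  · rintro ⟨c, hc, hv, hx, hy, hz⟩
    refine ⟨c, hc, v0, hv, ?_⟩
    have hs : {w : Fin r | w ≠ v0 ∧ c w ≠ 0 ∧ B (s v0) (s w) ≠ 0} = {x, y, z} := by
      ext w
      simp only [Set.mem_ofPred_eq, Set.mem_insert_iff, Set.mem_singleton_iff]
      rw [← h0 w]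
      constructor
      · rintro ⟨a, -, b⟩; exact ⟨a, b⟩
      · intro h
        refine ⟨h.1, ?_, h.2⟩
        rcases (h0 w).1 h with rfl | rfl | rfl <;> assumption
    rw [hs, Set.ncard_eq_three.2 ⟨x, y, z, hxy, hxz, hyz, rfl⟩]

/-! ### The exceptional cases -/

lemma E6_iff (α : Fin 7 → ℚ)
    (hα : α 1 + α 2 + α 3 + α 4 + α 5 + α 6 = -3 * α 0) :
    ThreeLegged (EnSimple 6) (fun v w => picDotQ v w) α ↔
      α 1 + α 2 + α 3 + 3 * α 0 ≠ 0 ∧ α 1 + α 2 + 2 * α 0 ≠ 0 ∧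
      α 1 + α 2 + α 3 + α 4 + 3 * α 0 ≠ 0 ∧ α 0 ≠ 0 := by
  rw [threeLegged_iff_aux _ _ _ 2 1 3 5 (by decide) (by decide) (by decide)
    (by decide +kernel) (by decide +kernel)]
  have hs : EnSimple 6 = ![![0,1,-1,0,0,0,0], ![0,0,1,-1,0,0,0], ![0,0,0,1,-1,0,0],
      ![0,0,0,0,1,-1,0], ![0,0,0,0,0,1,-1], ![1,-1,-1,-1,0,0,0]] := by decide +kernel
  constructor
  · rintro ⟨c, hc, h⟩
    rw [hs] at hc
    have e0 := congrFun hc 0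
    have e1 := congrFun hc 1
    have e2 := congrFun hc 2
    have e3 := congrFun hc 3
    have e4 := congrFun hc 4
    simp [Fin.sum_univ_succ] at e0 e1 e2 e3 e4
    obtain ⟨h2, h1, h3, h5⟩ := h
    refine ⟨fun h => h2 ?_, fun h => h1 ?_, fun h => h3 ?_, fun h => h5 ?_⟩ <;> linarith
  · intro h
    refine ⟨![α 1 + α 0, α 1 + α 2 + 2 * α 0, α 1 + α 2 + α 3 + 3 * α 0,
      α 1 + α 2 + α 3 + α 4 + 3 * α 0, α 1 + α 2 + α 3 + α 4 + α 5 + 3 * α 0, α 0], ?_, h⟩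
    rw [hs]
    ext i
    fin_cases i <;> simp [Fin.sum_univ_succ] <;> linarith

lemma E7_iff (α : Fin 8 → ℚ)
    (hα : α 1 + α 2 + α 3 + α 4 + α 5 + α 6 + α 7 = -3 * α 0) :
    ThreeLegged (EnSimple 7) (fun v w => picDotQ v w) α ↔
      α 1 + α 2 + α 3 + 3 * α 0 ≠ 0 ∧ α 1 + α 2 + 2 * α 0 ≠ 0 ∧
      α 1 + α 2 + α 3 + α 4 + 3 * α 0 ≠ 0 ∧ α 0 ≠ 0 := by
  rw [threeLegged_iff_aux _ _ _ 2 1 3 6 (by decide) (by decide) (by decide)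
    (by decide +kernel) (by decide +kernel)]
  have hs : EnSimple 7 = ![![0,1,-1,0,0,0,0,0], ![0,0,1,-1,0,0,0,0], ![0,0,0,1,-1,0,0,0],
      ![0,0,0,0,1,-1,0,0], ![0,0,0,0,0,1,-1,0], ![0,0,0,0,0,0,1,-1],
      ![1,-1,-1,-1,0,0,0,0]] := by decide +kernel
  constructor
  · rintro ⟨c, hc, h⟩
    rw [hs] at hc
    have e0 := congrFun hc 0
    have e1 := congrFun hc 1
    have e2 := congrFun hc 2
    have e3 := congrFun hc 3
    have e4 := congrFun hc 4
    simp [Fin.sum_univ_succ] at e0 e1 e2 e3 e4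
    obtain ⟨h2, h1, h3, h5⟩ := h
    refine ⟨fun h => h2 ?_, fun h => h1 ?_, fun h => h3 ?_, fun h => h5 ?_⟩ <;> linarith
  · intro h
    refine ⟨![α 1 + α 0, α 1 + α 2 + 2 * α 0, α 1 + α 2 + α 3 + 3 * α 0,
      α 1 + α 2 + α 3 + α 4 + 3 * α 0, α 1 + α 2 + α 3 + α 4 + α 5 + 3 * α 0,
      α 1 + α 2 + α 3 + α 4 + α 5 + α 6 + 3 * α 0, α 0], ?_, h⟩
    rw [hs]
    ext i
    fin_cases i <;> simp [Fin.sum_univ_succ] <;> linarith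

/-- The positive roots of `E₆` as a finset. -/
def E6Fin : Finset (Fin 7 → ℚ) :=
  ((Finset.univ.filter (fun p : Fin 6 × Fin 6 => p.1 < p.2)).image
      (fun p => picEQ 6 p.1 - picEQ 6 p.2)) ∪
  ((Finset.univ.filter (fun p : Fin 6 × Fin 6 × Fin 6 => p.1 < p.2.1 ∧ p.2.1 < p.2.2)).image
      (fun p => picHQ 6 - picEQ 6 p.1 - picEQ 6 p.2.1 - picEQ 6 p.2.2)) ∪
  {(2 : ℚ) • picHQ 6 - ∑ i : Fin 6, picEQ 6 i}

/-- The positive roots of `E₇` as a finset. -/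
def E7Fin : Finset (Fin 8 → ℚ) :=
  ((Finset.univ.filter (fun p : Fin 7 × Fin 7 => p.1 < p.2)).image
      (fun p => picEQ 7 p.1 - picEQ 7 p.2)) ∪
  ((Finset.univ.filter (fun p : Fin 7 × Fin 7 × Fin 7 => p.1 < p.2.1 ∧ p.2.1 < p.2.2)).image
      (fun p => picHQ 7 - picEQ 7 p.1 - picEQ 7 p.2.1 - picEQ 7 p.2.2)) ∪
  Finset.univ.image (fun i : Fin 7 => (2 : ℚ) • picHQ 7 - ∑ j ∈ Finset.univ.erase i, picEQ 7 j)

lemma mem_E6Fin (α : Fin 7 → ℚ) : α ∈ E6Fin ↔ α ∈ E6Pos := by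
  simp only [E6Fin, E6Pos, Finset.mem_union, Finset.mem_image, Finset.mem_filter,
    Finset.mem_univ, true_and, Finset.mem_singleton, Set.mem_ofPred_eq, Prod.exists, or_assoc,
    and_assoc, eq_comm (a := α)]

lemma mem_E7Fin (α : Fin 8 → ℚ) : α ∈ E7Fin ↔ α ∈ E7Pos := by
  simp only [E7Fin, E7Pos, Finset.mem_union, Finset.mem_image, Finset.mem_filter,
    Finset.mem_univ, true_and, Set.mem_ofPred_eq, Prod.exists, or_assoc,
    and_assoc, eq_comm (a := α)]

lemma E6_count :
    {α ∈ E6Pos | ThreeLegged (EnSimple 6) (fun v w => picDotQ v w) α}.ncard = 15 := by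
  have hsum : ∀ α ∈ E6Fin, α 1 + α 2 + α 3 + α 4 + α 5 + α 6 = -3 * α 0 := by decide +kernel
  have hset : {α ∈ E6Pos | ThreeLegged (EnSimple 6) (fun v w => picDotQ v w) α} =
      ((E6Fin.filter (fun α => α 1 + α 2 + α 3 + 3 * α 0 ≠ 0 ∧ α 1 + α 2 + 2 * α 0 ≠ 0 ∧
      α 1 + α 2 + α 3 + α 4 + 3 * α 0 ≠ 0 ∧ α 0 ≠ 0) : Finset (Fin 7 → ℚ)) :
        Set (Fin 7 → ℚ)) := by
    ext α
    simp only [Set.mem_ofPred_eq, Finset.coe_filter, mem_E6Fin]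
    exact and_congr_right (fun h => E6_iff α (hsum α ((mem_E6Fin α).2 h)))
  rw [hset, Set.ncard_coe_finset]
  decide +kernel

lemma E7_count :
    {α ∈ E7Pos | ThreeLegged (EnSimple 7) (fun v w => picDotQ v w) α}.ncard = 35 := by
  have hsum : ∀ α ∈ E7Fin, α 1 + α 2 + α 3 + α 4 + α 5 + α 6 + α 7 = -3 * α 0 := by
    decide +kernel
  have hset : {α ∈ E7Pos | ThreeLegged (EnSimple 7) (fun v w => picDotQ v w) α} =
      ((E7Fin.filter (fun α => α 1 + α 2 + α 3 + 3 * α 0 ≠ 0 ∧ α 1 + α 2 + 2 * α 0 ≠ 0 ∧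
      α 1 + α 2 + α 3 + α 4 + 3 * α 0 ≠ 0 ∧ α 0 ≠ 0) : Finset (Fin 8 → ℚ)) :
        Set (Fin 8 → ℚ)) := by
    ext α
    simp only [Set.mem_ofPred_eq, Finset.coe_filter, mem_E7Fin]
    exact and_congr_right (fun h => E7_iff α (hsum α ((mem_E7Fin α).2 h)))
  rw [hset, Set.ncard_coe_finset]
  decide +kernel

/-! ### The case of `D_n`, `n = m + 4` -/

lemma dotQ_eQ {n : ℕ} (a : Fin n) (w : Fin n → ℚ) : dotQ (eQ n a) w = w a := by
  simp [dotQ, eQ]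

lemma dotQ_add {n : ℕ} (u v w : Fin n → ℚ) : dotQ (u + v) w = dotQ u w + dotQ v w := by
  simp [dotQ, add_mul, Finset.sum_add_distrib]

lemma dotQ_sub {n : ℕ} (u v w : Fin n → ℚ) : dotQ (u - v) w = dotQ u w - dotQ v w := by
  simp [dotQ, sub_mul, Finset.sum_sub_distrib]

lemma DnSimple_apply (m : ℕ) (k j : Fin (m + 4)) :
    DnSimple (m + 4) k j =
      if k.val + 1 < m + 4 then
        (if j.val = k.val then 1 else 0) - (if j.val = k.val + 1 then 1 else 0)
      else (if j.val = m + 2 then 1 else 0) + (if j.val = m + 3 then 1 else 0) := by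
  unfold DnSimple
  split_ifs <;> simp_all [eQ, Fin.ext_iff]

lemma dotQ_DnSimple (m : ℕ) (k : Fin (m + 4)) (w : Fin (m + 4) → ℚ) :
    dotQ (DnSimple (m + 4) k) w =
      if h : k.val + 1 < m + 4 then w k - w ⟨k.val + 1, h⟩
      else w ⟨m + 2, by omega⟩ + w ⟨m + 3, by omega⟩ := by
  unfold DnSimple
  split_ifs
  · rw [dotQ_sub, dotQ_eQ, dotQ_eQ]
  · rw [dotQ_add, dotQ_eQ, dotQ_eQ]; rfl

lemma Dn_adj (m : ℕ) (v w : Fin (m + 4)) :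
    (w ≠ v ∧ dotQ (DnSimple (m + 4) v) (DnSimple (m + 4) w) ≠ 0) ↔
      ((w.val = v.val + 1 ∧ w.val < m + 3) ∨ (v.val = w.val + 1 ∧ v.val < m + 3) ∨
       (v.val = m + 1 ∧ w.val = m + 3) ∨ (v.val = m + 3 ∧ w.val = m + 1)) := by
  have hv := v.isLt
  have hw := w.isLt
  rw [dotQ_DnSimple, ne_eq w, Fin.ext_iff]
  by_cases h1 : v.val + 1 < m + 4 <;> by_cases h2 : w.val + 1 < m + 4
  · simp only [h1, h2, DnSimple_apply, dite_true, if_true]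
    split_ifs <;> (norm_num; omega)
  · simp only [h1, h2, DnSimple_apply, dite_true, if_false]
    split_ifs <;> (norm_num; omega)
  · simp only [h1, h2, DnSimple_apply, dite_false, if_true]
    split_ifs <;> (norm_num; omega)
  · omega

lemma Dn_span (m : ℕ) (α : Fin (m + 4) → ℚ) :
    ∃ c : Fin (m + 4) → ℚ, α = ∑ i, c i • DnSimple (m + 4) i := by
  set S := Submodule.span ℚ (Set.range (DnSimple (m + 4))) with hS
  have hs : ∀ k, DnSimple (m + 4) k ∈ S := fun k => Submodule.subset_span ⟨k, rfl⟩
  have he : ∀ d : ℕ, ∀ k : Fin (m + 4), k.val + d = m + 3 → eQ (m + 4) k ∈ S := by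
    intro d
    induction d with
    | zero =>
      intro k hk
      have : eQ (m + 4) k = (1 / 2 : ℚ) • (DnSimple (m + 4) ⟨m + 3, by omega⟩
          - DnSimple (m + 4) ⟨m + 2, by omega⟩) := by
        ext j
        simp only [Pi.smul_apply, Pi.sub_apply, DnSimple_apply, eQ, Fin.ext_iff, smul_eq_mul]
        split_ifs <;> first | omega | norm_num
      rw [this]
      exact S.smul_mem _ (S.sub_mem (hs _) (hs _))
    | succ d ih =>
      intro k hk
      have : eQ (m + 4) k = DnSimple (m + 4) k + eQ (m + 4) ⟨k.val + 1, by omega⟩ := by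
        ext j
        simp only [Pi.add_apply, DnSimple_apply, eQ, Fin.ext_iff]
        split_ifs <;> first | omega | norm_num
      rw [this]
      exact S.add_mem (hs _) (ih _ (by simp only; omega))
  have hα : α ∈ S := by
    have : α = ∑ i, α i • eQ (m + 4) i := by
      ext j
      simp [eQ]
    rw [this]
    exact S.sum_mem (fun i _ => S.smul_mem _ (he (m + 3 - i.val) i (by have := i.isLt; omega)))
  rw [hS, Submodule.mem_span_range_iff_exists_fun] at hα
  obtain ⟨c, hc⟩ := hα
  exact ⟨c, hc.symm⟩

/-- Partial sums of coordinates. -/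
def psum (m k : ℕ) (v : Fin (m + 4) → ℚ) : ℚ := ∑ i : Fin (m + 4), if i.val ≤ k then v i else 0

lemma psum_sum (m k : ℕ) (c : Fin (m + 4) → ℚ) (s : Fin (m + 4) → Fin (m + 4) → ℚ) :
    psum m k (∑ i, c i • s i) = ∑ i, c i * psum m k (s i) := by
  simp only [psum, Finset.mul_sum, Finset.sum_apply, Pi.smul_apply, smul_eq_mul]
  rw [Finset.sum_comm]
  refine Finset.sum_congr rfl (fun i _ => ?_)
  split_ifs <;> simp

lemma psum_add (m k : ℕ) (u v : Fin (m + 4) → ℚ) :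
    psum m k (u + v) = psum m k u + psum m k v := by
  simp only [psum, ← Finset.sum_add_distrib, Pi.add_apply]
  refine Finset.sum_congr rfl (fun i _ => ?_)
  split_ifs <;> simp

lemma psum_sub (m k : ℕ) (u v : Fin (m + 4) → ℚ) :
    psum m k (u - v) = psum m k u - psum m k v := by
  simp only [psum, ← Finset.sum_sub_distrib, Pi.sub_apply]
  refine Finset.sum_congr rfl (fun i _ => ?_)
  split_ifs <;> simp

lemma psum_eQ (m k : ℕ) (a : Fin (m + 4)) :
    psum m k (eQ (m + 4) a) = if a.val ≤ k then 1 else 0 := by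
  simp only [psum, eQ]
  rw [Finset.sum_eq_single a]
  · simp
  · intro b _ hb; simp [hb]
  · simp

lemma psum_DnSimple (m k : ℕ) (a : Fin (m + 4)) (hk : k ≤ m + 2) :
    psum m k (DnSimple (m + 4) a) =
      if a.val = k ∨ (k = m + 2 ∧ a.val = m + 3) then 1 else 0 := by
  have := a.isLt
  unfold DnSimple
  split_ifs <;> simp only [psum_sub, psum_add, psum_eQ] <;>
    split_ifs <;> first | omega | norm_num

lemma Dn_iff (m : ℕ) (α : Fin (m + 4) → ℚ) :
    ThreeLegged (DnSimple (m + 4)) (fun v w => dotQ v w) α ↔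
      psum m (m + 1) α ≠ 0 ∧ psum m m α ≠ 0 ∧
      psum m (m + 2) α - α ⟨m + 3, by omega⟩ ≠ 0 ∧
      psum m (m + 2) α + α ⟨m + 3, by omega⟩ ≠ 0 := by
  rw [threeLegged_iff_aux _ _ _ ⟨m + 1, by omega⟩ ⟨m, by omega⟩ ⟨m + 2, by omega⟩
    ⟨m + 3, by omega⟩ (by simp) (by simp) (by simp)
    (by
      intro w
      refine (Dn_adj m _ w).trans ?_
      have hw := w.isLt
      simp only [Fin.ext_iff, true_and]
      omega)
    (by
      intro v hv
      simp only [ne_eq, Fin.ext_iff] at hv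
      have hvlt := v.isLt
      by_cases h : v.val < m + 1
      · refine ⟨⟨v.val - 1, by omega⟩, ⟨v.val + 1, by omega⟩, fun w h1 h2 => ?_⟩
        have := (Dn_adj m v w).1 ⟨h1, h2⟩
        simp only [Fin.ext_iff]
        omega
      · refine ⟨⟨m + 1, by omega⟩, ⟨m + 1, by omega⟩, fun w h1 h2 => ?_⟩
        have := (Dn_adj m v w).1 ⟨h1, h2⟩
        simp only [Fin.ext_iff]
        omega)]
  have key : ∀ c : Fin (m + 4) → ℚ, α = ∑ i, c i • DnSimple (m + 4) i →
      psum m (m + 1) α = c ⟨m + 1, by omega⟩ ∧ psum m m α = c ⟨m, by omega⟩ ∧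
      psum m (m + 2) α - α ⟨m + 3, by omega⟩ = 2 * c ⟨m + 2, by omega⟩ ∧
      psum m (m + 2) α + α ⟨m + 3, by omega⟩ = 2 * c ⟨m + 3, by omega⟩ := by
    intro c hc
    have h1 : ∀ k (hk : k ≤ m + 1), psum m k α = c ⟨k, by omega⟩ := by
      intro k hk
      rw [hc, psum_sum, Finset.sum_eq_single ⟨k, by omega⟩]
      · rw [psum_DnSimple _ _ _ (by omega)]; simp
      · intro b _ hb
        rw [psum_DnSimple _ _ _ (by omega), if_neg, mul_zero]
        simp only [ne_eq, Fin.ext_iff] at hb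
        omega
      · simp
    have h2 : psum m (m + 2) α = c ⟨m + 2, by omega⟩ + c ⟨m + 3, by omega⟩ := by
      rw [hc, psum_sum, Finset.sum_eq_add ⟨m + 2, by omega⟩ ⟨m + 3, by omega⟩ (by simp)]
      · rw [psum_DnSimple _ _ _ (by omega), psum_DnSimple _ _ _ (by omega)]; simp
      · intro b _ hb
        rw [psum_DnSimple _ _ _ (by omega), if_neg, mul_zero]
        simp only [ne_eq, Fin.ext_iff] at hb
        omega
      · simp
      · simp
    have h3 : α ⟨m + 3, by omega⟩ = c ⟨m + 3, by omega⟩ - c ⟨m + 2, by omega⟩ := by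
      have := congrFun hc ⟨m + 3, by omega⟩
      rw [this, Finset.sum_apply,
        Finset.sum_eq_add ⟨m + 2, by omega⟩ ⟨m + 3, by omega⟩ (by simp)]
      · simp only [Pi.smul_apply, DnSimple_apply, smul_eq_mul]
        simp
        ring
      · intro b _ hb
        have hb' := b.isLt
        simp only [ne_eq, Fin.ext_iff] at hb
        simp only [Pi.smul_apply, DnSimple_apply, smul_eq_mul]
        split_ifs <;> first | omega | norm_num
      · simp
      · simp
    refine ⟨h1 _ le_rfl, h1 _ (by omega), ?_, ?_⟩ <;> rw [h2, h3] <;> ring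
  constructor
  · rintro ⟨c, hc, h⟩
    obtain ⟨k1, k2, k3, k4⟩ := key c hc
    rw [k1, k2, k3, k4]
    simpa using h
  · intro h
    obtain ⟨c, hc⟩ := Dn_span m α
    obtain ⟨k1, k2, k3, k4⟩ := key c hc
    rw [k1, k2, k3, k4] at h
    exact ⟨c, hc, by simpa using h⟩

/-- The vector attached to a pair `(j, i)` of indices, as natural numbers. -/
def pairVec (m : ℕ) (p : Σ _ : ℕ, ℕ) : Fin (m + 4) → ℚ :=
  fun k => if k.val = p.1 ∨ k.val = p.2 then 1 else 0

/-- Index set of the three-legged positive roots of `D_{m+4}`. -/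
def pairSet (m : ℕ) : Finset (Σ _ : ℕ, ℕ) :=
  ((Finset.range (m + 3)).sigma (fun j => Finset.range j)).erase ⟨m + 2, m + 1⟩

lemma mem_pairSet (m j i : ℕ) :
    (⟨j, i⟩ : Σ _ : ℕ, ℕ) ∈ pairSet m ↔ i < j ∧ j ≤ m + 2 ∧ i ≤ m := by
  simp only [pairSet, Finset.mem_erase, Finset.mem_sigma, Finset.mem_range, ne_eq,
    Sigma.mk.injEq, heq_eq_eq]
  omega

lemma card_pairSet (m : ℕ) : (pairSet m).card = (m + 4) * (m + 4 - 3) / 2 := by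
  rw [pairSet, Finset.card_erase_of_mem (by simp), Finset.card_sigma]
  simp only [Finset.card_range]
  rw [Finset.sum_range_id]
  have : (m + 3) * (m + 3 - 1) = (m + 4) * (m + 4 - 3) + 2 := by
    have h1 : m + 3 - 1 = m + 2 := by omega
    have h2 : m + 4 - 3 = m + 1 := by omega
    rw [h1, h2]; ring
  omega

lemma pairVec_inj (m : ℕ) : Set.InjOn (pairVec m) (pairSet m) := by
  rintro ⟨j, i⟩ h ⟨j', i'⟩ h' heq
  rw [Finset.mem_coe, mem_pairSet] at h h'
  have key : ∀ k, k < m + 4 → ((k = j ∨ k = i) ↔ (k = j' ∨ k = i')) := by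
    intro k hk
    have := congrFun heq ⟨k, hk⟩
    simp only [pairVec] at this
    split_ifs at this <;> simp_all
  have k1 := key j (by omega)
  have k2 := key i (by omega)
  have k3 := key j' (by omega)
  have k4 := key i' (by omega)
  have e1 : j = j' := by omega
  have e2 : i = i' := by omega
  rw [e1, e2]

lemma Dn_set (m : ℕ) :
    {α ∈ DnPos (m + 4) | ThreeLegged (DnSimple (m + 4)) (fun v w => dotQ v w) α} =
      Set.image (pairVec m) (pairSet m) := by
  have hv : ∀ i j : Fin (m + 4), i < j →
      pairVec m ⟨j.val, i.val⟩ = eQ (m + 4) i + eQ (m + 4) j := by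
    intro i j hij
    rw [Fin.lt_def] at hij
    ext k
    simp only [pairVec, eQ, Pi.add_apply, Fin.ext_iff]
    split_ifs <;> first | omega | norm_num
  ext α
  simp only [Set.mem_ofPred_eq, Set.mem_image, Finset.mem_coe]
  rw [Dn_iff]
  constructor
  · rintro ⟨⟨i, j, hij, rfl | rfl⟩, h⟩
    · exfalso
      rw [Fin.lt_def] at hij
      have := j.isLt
      simp only [psum_sub, psum_eQ, Pi.sub_apply, eQ, Fin.ext_iff] at h
      obtain ⟨-, -, h3, h4⟩ := h
      by_cases hj : j.val = m + 3
      · apply h4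
        split_ifs <;> first | omega | norm_num
      · apply h3
        split_ifs <;> first | omega | norm_num
    · refine ⟨⟨j.val, i.val⟩, ?_, hv i j hij⟩
      rw [Fin.lt_def] at hij
      have := j.isLt
      rw [mem_pairSet]
      simp only [psum_add, psum_eQ, Pi.add_apply, eQ, Fin.ext_iff] at h
      obtain ⟨-, h2, h3, -⟩ := h
      refine ⟨hij, ?_, ?_⟩
      · by_contra hj
        apply h3
        split_ifs <;> first | omega | norm_num
      · by_contra hj
        apply h2
        split_ifs <;> first | omega | norm_num
  · rintro ⟨⟨j, i⟩, h, rfl⟩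
    rw [mem_pairSet] at h
    have hlt : (⟨i, by omega⟩ : Fin (m + 4)) < ⟨j, by omega⟩ := h.1
    have := hv _ _ hlt
    simp only at this
    rw [this]
    refine ⟨⟨_, _, hlt, Or.inr rfl⟩, ?_⟩
    simp only [psum_add, psum_eQ, Pi.add_apply, eQ, Fin.ext_iff]
    refine ⟨?_, ?_, ?_, ?_⟩ <;> split_ifs <;> first | omega | norm_num

lemma Dn_count (n : ℕ) :
    {α ∈ DnPos n | ThreeLegged (DnSimple n) (fun v w => dotQ v w) α}.ncard
        = n * (n - 3) / 2 := by
  rcases Nat.lt_or_ge n 4 with h | h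
  · have h0 : n - 3 = 0 := by omega
    have : {α ∈ DnPos n | ThreeLegged (DnSimple n) (fun v w => dotQ v w) α} = ∅ := by
      rw [Set.eq_empty_iff_forall_notMem]
      rintro α ⟨-, c, -, v, -, h3⟩
      have hsub : {w : Fin n | w ≠ v ∧ c w ≠ 0 ∧
          (fun v w => dotQ v w) (DnSimple n v) (DnSimple n w) ≠ 0} ⊆
          ((Finset.univ.erase v : Finset (Fin n)) : Set (Fin n)) := by
        intro w hw
        simpa using hw.1
      have hle := Set.ncard_le_ncard hsub (Set.toFinite _)
      rw [Set.ncard_coe_finset, Finset.card_erase_of_mem (Finset.mem_univ v),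
        Finset.card_univ, Fintype.card_fin] at hle
      omega
    rw [this, h0]
    simp
  · obtain ⟨m, rfl⟩ : ∃ m, n = m + 4 := ⟨n - 4, by omega⟩
    rw [Dn_set, (pairVec_inj m).ncard_image, Set.ncard_coe_finset, card_pairSet]

/-- The number of positive roots whose support has a trivalent vertex is `n(n−3)/2`
for `D_n` (`n ≥ 2`), `15` for `E₆`, and `35` for `E₇`. -/
theorem threeLegged_counts :
    (∀ n : ℕ, 2 ≤ n →
      {α ∈ DnPos n | ThreeLegged (DnSimple n) (fun v w => dotQ v w) α}.ncard
        = n * (n - 3) / 2) ∧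
    {α ∈ E6Pos | ThreeLegged (EnSimple 6) (fun v w => picDotQ v w) α}.ncard = 15 ∧
    {α ∈ E7Pos | ThreeLegged (EnSimple 7) (fun v w => picDotQ v w) α}.ncard = 35 := by
  exact ⟨fun n _ => Dn_count n, E6_count, E7_count⟩
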